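/- The composite homomorphism λ∘τ: Aut_{k-Lie}(L̂(𝔤)_S) → Aut_{k-Lie}(L(𝔤)_S) (restrict an automorphism to the derived subalgebra L̃(𝔤)_S, then pass to the quotient by the centre kc) is surjective, and its kernel is isomorphic to the additive group V = Hom_k(kd, kc) ≅ (k,+); i.e. the sequence 1 → V → Aut_{k-Lie}(L̂(𝔤)_S) → Aut_{k-Lie}(L(𝔤)_S) → 1 is exact. -/

import Mathlib

open LaurentPolynomial TensorProduct

noncomputable section

namespace LieAlgebra.IsSimple

variable {k 𝔤 : Type*} [Field k] [LieRing 𝔤] [LieAlgebra k 𝔤] [IsSimple k 𝔤]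

theorem eq_zero_of_forall_lie_eq_zero (k : Type*) {𝔤 : Type*} [Field k] [LieRing 𝔤]
    [LieAlgebra k 𝔤] [IsSimple k 𝔤] {x : 𝔤} (hx : ∀ y : 𝔤, ⁅x, y⁆ = 0) : x = 0 := by
  have h : x ∈ LieAlgebra.center k 𝔤 := by
    rw [LieModule.mem_maxTrivSubmodule]
    intro y
    rw [← lie_skew, hx, neg_zero]
  rwa [LieAlgebra.center_eq_bot, LieSubmodule.mem_bot] at h

variable (k 𝔤) in
theorem span_lie_eq_top : Submodule.span k {z : 𝔤 | ∃ x y : 𝔤, ⁅x, y⁆ = z} = ⊤ := by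
  have h : ⁅(⊤ : LieIdeal k 𝔤), (⊤ : LieIdeal k 𝔤)⁆ = ⊤ := by
    refine (eq_bot_or_eq_top _).resolve_left fun h ↦ non_abelian k (L := 𝔤) ?_
    refine ⟨fun x y ↦ ?_⟩
    have hxy := LieSubmodule.lie_mem_lie (LieSubmodule.mem_top (R := k) (L := 𝔤) x)
      (LieSubmodule.mem_top (R := k) (L := 𝔤) y)
    rwa [h, LieSubmodule.mem_bot] at hxy
  have h' := LieSubmodule.lieIdeal_oper_eq_linear_span' (⊤ : LieIdeal k 𝔤) (⊤ : LieIdeal k 𝔤)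
  rw [h] at h'
  simpa using h'.symm

theorem linearMap_ext_lie {M : Type*} [AddCommGroup M] [Module k M] {f g : 𝔤 →ₗ[k] M}
    (h : ∀ x y : 𝔤, f ⁅x, y⁆ = g ⁅x, y⁆) : f = g := by
  refine LinearMap.ext_on (span_lie_eq_top k 𝔤) ?_
  rintro _ ⟨x, y, rfl⟩
  exact h x y

variable [FiniteDimensional k 𝔤]

variable (k 𝔤) in
theorem exists_killingForm_lie_ne_zero [CharZero k] : ∃ x y z : 𝔤, killingForm k 𝔤 ⁅x, y⁆ z ≠ 0 := by
  by_contra! h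
  refine non_abelian k (L := 𝔤) ⟨fun x y ↦ ?_⟩
  exact (LieAlgebra.IsKilling.killingForm_nondegenerate k 𝔤).1 _ (h x y)

variable [IsAlgClosed k]

/-- Schur's lemma for the adjoint module. -/
theorem exists_eq_smul_of_comm_lie (A : 𝔤 →ₗ[k] 𝔤) (hA : ∀ y z : 𝔤, A ⁅y, z⁆ = ⁅y, A z⁆) :
    ∃ a : k, ∀ z, A z = a • z := by
  have := nontrivial k 𝔤
  obtain ⟨a, ha⟩ := Module.End.exists_eigenvalue A
  let I : LieIdeal k 𝔤 :=
    { Module.End.eigenspace A a with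
      lie_mem := by
        intro x m hm
        have hm' : A m = a • m := Module.End.mem_eigenspace_iff.mp hm
        exact Module.End.mem_eigenspace_iff.mpr (by rw [hA, hm', lie_smul]) }
  have hI : I = ⊤ := by
    refine (eq_bot_or_eq_top I).resolve_left fun h ↦ ?_
    obtain ⟨v, hv⟩ := ha.exists_hasEigenvector
    have hvI : v ∈ I := hv.1
    rw [h, LieSubmodule.mem_bot] at hvI
    exact hv.2 hvI
  refine ⟨a, fun z ↦ Module.End.mem_eigenspace_iff.mp ?_⟩
  change z ∈ I
  simp [hI]

variable [CharZero k]

theorem exists_eq_mul_killingForm (β : 𝔤 →ₗ[k] 𝔤 →ₗ[k] k)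
    (hβ : ∀ x y z : 𝔤, β ⁅x, y⁆ z = -β y ⁅x, z⁆) :
    ∃ a : k, ∀ y z, β y z = a * killingForm k 𝔤 y z := by
  have hnd := LieAlgebra.IsKilling.killingForm_nondegenerate k 𝔤
  let e : 𝔤 ≃ₗ[k] Module.Dual k 𝔤 := (killingForm k 𝔤).toDual hnd
  have he : ∀ y z, killingForm k 𝔤 (e.symm (β y)) z = β y z := fun y z ↦
    LinearMap.BilinForm.apply_toDual_symm_apply (hB := hnd) (β y) z
  obtain ⟨a, ha⟩ := exists_eq_smul_of_comm_lie (e.symm.toLinearMap ∘ₗ β) (by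
    intro y z
    apply e.injective
    ext w
    change killingForm k 𝔤 (e.symm (β ⁅y, z⁆)) w = killingForm k 𝔤 ⁅y, e.symm (β z)⁆ w
    rw [he, hβ, ← lie_skew y (e.symm (β z)), map_neg, LinearMap.neg_apply,
      LieModule.traceForm_apply_lie_apply, he])
  refine ⟨a, fun y z ↦ ?_⟩
  rw [← he]
  change killingForm k 𝔤 ((e.symm.toLinearMap ∘ₗ β) y) z = _
  rw [ha, map_smul, LinearMap.smul_apply, smul_eq_mul]

end LieAlgebra.IsSimple

theorem LieDerivation.exists_eq_lie_of_isSimple {k 𝔤 : Type*} [Field k] [CharZero k] [LieRing 𝔤]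
    [LieAlgebra k 𝔤] [FiniteDimensional k 𝔤] [LieAlgebra.IsSimple k 𝔤] (E : 𝔤 →ₗ[k] 𝔤)
    (hE : ∀ y z : 𝔤, E ⁅y, z⁆ = ⁅y, E z⁆ + ⁅E y, z⁆) : ∃ x : 𝔤, ∀ y : 𝔤, E y = ⁅x, y⁆ := by
  let D : LieDerivation k 𝔤 𝔤 := ⟨E, fun y z ↦ by rw [hE, ← lie_skew z, sub_neg_eq_add]⟩
  obtain ⟨x, hx⟩ := LieDerivation.IsKilling.exists_eq_ad D
  exact ⟨x, fun y ↦ by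
    rw [← LieDerivation.ad_apply_apply (R := k), hx]; rfl⟩
namespace AddMonoidAlgebra

/-- Units of the Laurent polynomial ring over a domain are monomials. -/
theorem exists_eq_single_of_mul_eq_one {R : Type*} [CommRing R] [IsDomain R]
    {f g : AddMonoidAlgebra R ℤ} (h : f * g = 1) : ∃ n a, a ≠ 0 ∧ f = single n a := by
  have hf : f ≠ 0 := by rintro rfl; simp at h
  have hg : g ≠ 0 := by rintro rfl; simp at h
  have hfs : f.coeff.support.Nonempty := by simpa using hf
  have hgs : g.coeff.support.Nonempty := by simpa using hg
  have key : f.coeff.support.card * g.coeff.support.card ≤ 1 := by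
    by_contra! hlt
    obtain ⟨p, hp, q, hq, hpq, hup, huq⟩ := TwoUniqueSums.uniqueAdd_of_one_lt_card hlt
    have hzero : ∀ r ∈ f.coeff.support ×ˢ g.coeff.support,
        UniqueAdd f.coeff.support g.coeff.support r.1 r.2 → r.1 + r.2 = 0 := by
      intro r hr hur
      rw [Finset.mem_product, Finsupp.mem_support_iff, Finsupp.mem_support_iff] at hr
      by_contra h0
      have := coeff_mul_add_of_uniqueAdd hur
      rw [h, one_def, coeff_single, Finsupp.single_eq_of_ne h0] at this
      exact mul_ne_zero hr.1 hr.2 this.symm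
    have hp' := Finset.mem_product.mp hp
    have := huq hp'.1 hp'.2 (by rw [hzero p hp hup, hzero q hq huq])
    exact hpq (Prod.ext this.1 this.2)
  have hcard : f.coeff.support.card = 1 := by
    have h1 := hfs.card_pos
    have h2 := hgs.card_pos
    nlinarith
  obtain ⟨n, a, ha, hfa⟩ := Finsupp.card_support_eq_one'.mp hcard
  exact ⟨n, a, ha, coeff_injective hfa⟩

end AddMonoidAlgebra

/-- The maps `y ↦ y ⊗ sᵖ` exhibit `L` as the loop algebra of `𝔤`. -/
structure IsLoopAlgebra {k 𝔤 L : Type*} [Field k] [LieRing 𝔤] [LieAlgebra k 𝔤] [LieRing L]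
    [LieAlgebra k L] (u : ℤ → 𝔤 →ₗ[k] L) : Prop where
  lie : ∀ (p q : ℤ) (y z : 𝔤), ⁅u p y, u q z⁆ = u (p + q) ⁅y, z⁆
  span : ∀ l : L, ∃ f : ℤ →₀ 𝔤, l = f.sum fun i y ↦ u i y
  ind : ∀ f : ℤ →₀ 𝔤, (f.sum fun i y ↦ u i y) = 0 → f = 0

namespace IsLoopAlgebra

open LieAlgebra.IsSimple

variable {k 𝔤 L : Type*} [Field k] [LieRing 𝔤] [LieAlgebra k 𝔤] [LieRing L]
    [LieAlgebra k L] {u : ℤ → 𝔤 →ₗ[k] L} (hu : IsLoopAlgebra u)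

section Coordinates

include hu in
theorem bijective_lsum : Function.Bijective (Finsupp.lsum k u) := by
  refine ⟨(injective_iff_map_eq_zero _).mpr hu.ind, fun l ↦ ?_⟩
  obtain ⟨f, hf⟩ := hu.span l
  exact ⟨f, hf.symm⟩

/-- The Laurent coefficients of an element of a loop algebra. -/
def coeffs : L ≃ₗ[k] ℤ →₀ 𝔤 := (LinearEquiv.ofBijective _ hu.bijective_lsum).symm

@[simp]
theorem coeffs_apply (p : ℤ) (y : 𝔤) : hu.coeffs (u p y) = Finsupp.single p y := by
  rw [coeffs, LinearEquiv.symm_apply_eq, LinearEquiv.ofBijective_apply, Finsupp.lsum_single]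

/-- A linear map out of a loop algebra is given by its values on the pure loops. -/
def lift {M : Type*} [AddCommGroup M] [Module k M] (F : ℤ → 𝔤 →ₗ[k] M) : L →ₗ[k] M :=
  Finsupp.lsum k F ∘ₗ hu.coeffs.toLinearMap

@[simp]
theorem lift_apply {M : Type*} [AddCommGroup M] [Module k M] (F : ℤ → 𝔤 →ₗ[k] M) (p : ℤ)
    (y : 𝔤) : hu.lift F (u p y) = F p y := by
  simp [lift]

include hu

theorem linearMap_ext {M : Type*} [AddCommGroup M] [Module k M] {F G : L →ₗ[k] M}
    (h : ∀ p y, F (u p y) = G (u p y)) : F = G := by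
  ext l
  obtain ⟨f, rfl⟩ := hu.span l
  simp [Finsupp.sum, h]

theorem bilin_ext {M : Type*} [AddCommGroup M] [Module k M] {F G : L →ₗ[k] L →ₗ[k] M}
    (h : ∀ p y q z, F (u p y) (u q z) = G (u p y) (u q z)) : F = G :=
  hu.linearMap_ext fun p y ↦ hu.linearMap_ext fun q z ↦ h p y q z

theorem coeffs_lie_apply_zero (a : L) (y : 𝔤) (q : ℤ) :
    hu.coeffs ⁅a, u 0 y⁆ q = ⁅hu.coeffs a q, y⁆ := by
  obtain ⟨f, rfl⟩ := hu.span a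
  simp only [Finsupp.sum, sum_lie, map_sum, Finsupp.finsetSum_apply, hu.lie,
    add_zero, coeffs_apply, sum_lie]
  refine Finset.sum_congr rfl fun p _ ↦ ?_
  by_cases hp : p = q
  · subst hp; simp
  · simp [Finsupp.single_eq_of_ne (Ne.symm hp)]

theorem coeffs_apply_zero_lie (a : L) (y : 𝔤) (q : ℤ) :
    hu.coeffs ⁅u 0 y, a⁆ q = ⁅y, hu.coeffs a q⁆ := by
  rw [← lie_skew, map_neg, Finsupp.neg_apply, hu.coeffs_lie_apply_zero, lie_skew]

end Coordinates

section Operators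

/-- The degree derivation `s d/ds` of a loop algebra. -/
def deg : L →ₗ[k] L := hu.lift fun p ↦ (p : k) • u p

@[simp]
theorem deg_apply (p : ℤ) (y : 𝔤) : hu.deg (u p y) = (p : k) • u p y := by simp [deg]

theorem deg_lie (a b : L) : hu.deg ⁅a, b⁆ = ⁅hu.deg a, b⁆ + ⁅a, hu.deg b⁆ := by
  have := hu.bilin_ext
    (F := (LieModule.toEnd k L L : L →ₗ[k] L →ₗ[k] L).compr₂ hu.deg)
    (G := (LieModule.toEnd k L L : L →ₗ[k] L →ₗ[k] L) ∘ₗ hu.deg +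
      (LieModule.toEnd k L L : L →ₗ[k] L →ₗ[k] L).compl₂ hu.deg)
    (fun p y q z ↦ by simp [hu.lie, add_smul])
  exact LinearMap.congr_fun₂ this a b

/-- Multiplication by `sⁿ` on a loop algebra. -/
def shift (n : ℤ) : L →ₗ[k] L := hu.lift fun p ↦ u (p + n)

@[simp]
theorem shift_apply (n p : ℤ) (y : 𝔤) : hu.shift n (u p y) = u (p + n) y := by simp [shift]

theorem shift_lie (n : ℤ) (a b : L) : hu.shift n ⁅a, b⁆ = ⁅a, hu.shift n b⁆ := by
  have := hu.bilin_ext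
    (F := (LieModule.toEnd k L L : L →ₗ[k] L →ₗ[k] L).compr₂ (hu.shift n))
    (G := (LieModule.toEnd k L L : L →ₗ[k] L →ₗ[k] L).compl₂ (hu.shift n))
    (fun p y q z ↦ by simp [hu.lie, add_assoc])
  exact LinearMap.congr_fun₂ this a b

theorem shift_zero : hu.shift 0 = 1 := hu.linearMap_ext fun p y ↦ by simp

theorem shift_add (m n : ℤ) : hu.shift (m + n) = hu.shift m * hu.shift n :=
  hu.linearMap_ext fun p y ↦ by simp [add_comm m n, add_assoc]

theorem deg_shift (n : ℤ) (l : L) :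
    hu.deg (hu.shift n l) = hu.shift n (hu.deg l) + (n : k) • hu.shift n l := by
  have := hu.linearMap_ext (F := hu.deg ∘ₗ hu.shift n)
    (G := hu.shift n ∘ₗ hu.deg + (n : k) • hu.shift n) (fun p y ↦ by simp [add_smul])
  exact LinearMap.congr_fun this l

/-- The action of the Laurent polynomials on a loop algebra. -/
def mulBy : AddMonoidAlgebra k ℤ →ₐ[k] Module.End k L :=
  AddMonoidAlgebra.lift k _ ℤ
    { toFun n := hu.shift n.toAdd
      map_one' := hu.shift_zero
      map_mul' m n := hu.shift_add m.toAdd n.toAdd }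

theorem mulBy_single (n : ℤ) (a : k) :
    hu.mulBy (AddMonoidAlgebra.single n a) = a • hu.shift n := by
  rw [mulBy, AddMonoidAlgebra.lift_single]; rfl

theorem mulBy_apply (h : AddMonoidAlgebra k ℤ) (l : L) :
    hu.mulBy h l = h.coeff.sum fun n a ↦ a • hu.shift n l := by
  rw [mulBy, AddMonoidAlgebra.lift_apply, Finsupp.sum, LinearMap.sum_apply]; rfl

theorem mulBy_lie (h : AddMonoidAlgebra k ℤ) (a b : L) :
    hu.mulBy h ⁅a, b⁆ = ⁅a, hu.mulBy h b⁆ := by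
  simp [mulBy_apply, Finsupp.sum, shift_lie, lie_sum]

theorem mulBy_lie_left (h : AddMonoidAlgebra k ℤ) (a b : L) :
    hu.mulBy h ⁅a, b⁆ = ⁅hu.mulBy h a, b⁆ := by
  rw [← lie_skew, map_neg, mulBy_lie, lie_skew]

theorem coeffs_mulBy (h : AddMonoidAlgebra k ℤ) (p q : ℤ) (y : 𝔤) :
    hu.coeffs (hu.mulBy h (u p y)) (p + q) = h.coeff q • y := by
  simp only [mulBy_apply, Finsupp.sum, map_sum, map_smul, shift_apply, coeffs_apply,
    Finsupp.finsetSum_apply, Finsupp.smul_apply]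
  rw [Finset.sum_eq_single q]
  · simp
  · intro n _ hn
    rw [Finsupp.single_eq_of_ne (by simpa using hn.symm), smul_zero]
  · intro hq
    rw [Finsupp.notMem_support_iff.mp hq, zero_smul]

theorem eq_zero_of_mulBy_apply_eq_zero {h : AddMonoidAlgebra k ℤ} {p : ℤ} {y : 𝔤} (hy : y ≠ 0)
    (h0 : hu.mulBy h (u p y) = 0) : h = 0 := by
  apply AddMonoidAlgebra.coeff_injective
  ext q
  have := hu.coeffs_mulBy h p q y
  rw [h0, map_zero, Finsupp.zero_apply, eq_comm, smul_eq_zero] at this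
  simpa using this.resolve_right hy

/-- The residue form `(y ⊗ sᵖ, z ⊗ s^q) ↦ δ_{p+q,0} ⟨y, z⟩` on a loop algebra. -/
def form : L →ₗ[k] L →ₗ[k] k :=
  hu.lift fun p ↦ (hu.lift fun q ↦
    if p + q = 0 then (killingForm k 𝔤).flip else 0).flip

@[simp]
theorem form_apply (p q : ℤ) (y z : 𝔤) :
    hu.form (u p y) (u q z) = if p + q = 0 then killingForm k 𝔤 y z else 0 := by
  simp only [form, lift_apply, LinearMap.flip_apply]
  split_ifs <;> simp

theorem form_lie (x a b : L) : hu.form ⁅x, a⁆ b = -hu.form a ⁅x, b⁆ := by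
  have key : ∀ r v, hu.form ∘ₗ (LieModule.toEnd k L L (u r v)) =
      -(hu.form.compl₂ (LieModule.toEnd k L L (u r v))) := by
    refine fun r v ↦ hu.bilin_ext fun p y q z ↦ ?_
    simp only [LinearMap.comp_apply, LieModule.toEnd_apply_apply, LinearMap.neg_apply,
      LinearMap.compl₂_apply, hu.lie, form_apply]
    rw [show r + p + q = p + (r + q) by ring]
    split_ifs
    · rw [← lie_skew, map_neg, LinearMap.neg_apply, LieModule.traceForm_apply_lie_apply]
    · simp
  obtain ⟨f, rfl⟩ := hu.span x
  have h : ∀ r v, hu.form ⁅u r v, a⁆ b = -hu.form a ⁅u r v, b⁆ := fun r v ↦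
    LinearMap.congr_fun₂ (key r v) a b
  simp [Finsupp.sum, sum_lie, h]

theorem form_comm (a b : L) : hu.form a b = hu.form b a := by
  have := hu.bilin_ext (F := hu.form) (G := hu.form.flip) (fun p y q z ↦ by
    rw [LinearMap.flip_apply, form_apply, form_apply, add_comm q, LieModule.traceForm_comm])
  exact LinearMap.congr_fun₂ this a b

theorem form_deg (a b : L) : hu.form (hu.deg a) b = -hu.form a (hu.deg b) := by
  have := hu.bilin_ext (F := hu.form ∘ₗ hu.deg) (G := -(hu.form.compl₂ hu.deg))
    (fun p y q z ↦ by
      simp only [LinearMap.comp_apply, deg_apply, LinearMap.neg_apply, map_smul,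
        LinearMap.compl₂_apply, LinearMap.smul_apply, form_apply]
      split_ifs with hpq
      · rw [eq_neg_of_add_eq_zero_left hpq]; simp
      · simp)
  exact LinearMap.congr_fun₂ this a b

end Operators

section Structure

variable [LieAlgebra.IsSimple k 𝔤]

include hu in
theorem eq_zero_of_forall_lie_apply_zero {x : L} (hx : ∀ y : 𝔤, ⁅x, u 0 y⁆ = 0) : x = 0 := by
  apply hu.coeffs.injective
  ext q
  rw [map_zero, Finsupp.zero_apply]
  refine eq_zero_of_forall_lie_eq_zero k fun y ↦ ?_
  rw [← hu.coeffs_lie_apply_zero, hx, map_zero, Finsupp.zero_apply]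

theorem mulBy_injective : Function.Injective hu.mulBy := by
  have := nontrivial k 𝔤
  obtain ⟨y, hy⟩ := exists_ne (0 : 𝔤)
  refine (injective_iff_map_eq_zero _).mpr fun h h0 ↦
    hu.eq_zero_of_mulBy_apply_eq_zero (p := 0) hy ?_
  rw [h0, LinearMap.zero_apply]

include hu in
theorem linearMap_ext_lie {M : Type*} [AddCommGroup M] [Module k M] {F G : L →ₗ[k] M}
    (h : ∀ a b : L, F ⁅a, b⁆ = G ⁅a, b⁆) : F = G := by
  refine hu.linearMap_ext fun p ↦ LinearMap.congr_fun (f := F ∘ₗ u p) (g := G ∘ₗ u p) ?_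
  refine LieAlgebra.IsSimple.linearMap_ext_lie fun y z ↦ ?_
  have := h (u p y) (u 0 z)
  rwa [hu.lie, add_zero] at this

variable [FiniteDimensional k 𝔤]

include hu in
/-- A derivation from `𝔤` to the loop algebra is inner. -/
theorem exists_eq_lie_of_derivation [CharZero k] (E : 𝔤 →ₗ[k] L)
    (hE : ∀ y z : 𝔤, E ⁅y, z⁆ = ⁅u 0 y, E z⁆ + ⁅E y, u 0 z⁆) :
    ∃ x : L, ∀ y : 𝔤, E y = ⁅x, u 0 y⁆ := by
  have hcomp : ∀ q : ℤ, ∃ x : 𝔤, ∀ y : 𝔤, hu.coeffs (E y) q = ⁅x, y⁆ := fun q ↦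
    LieDerivation.exists_eq_lie_of_isSimple
      (Finsupp.lapply q ∘ₗ hu.coeffs.toLinearMap ∘ₗ E) fun y z ↦ by
        simp [hE, hu.coeffs_lie_apply_zero, hu.coeffs_apply_zero_lie]
  choose x hx using hcomp
  classical
  let b := Module.finBasis k 𝔤
  let s : Finset ℤ := Finset.univ.biUnion fun i ↦ (hu.coeffs (E (b i))).support
  have hs : ∀ q, x q ≠ 0 → q ∈ s := by
    intro q hq
    by_contra hqs
    refine hq (eq_zero_of_forall_lie_eq_zero k fun y ↦ ?_)
    rw [← hx]
    refine LinearMap.congr_fun (f := Finsupp.lapply q ∘ₗ hu.coeffs.toLinearMap ∘ₗ E) (g := 0)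
      (b.ext fun i ↦ ?_) y
    simp only [s, Finset.mem_biUnion, Finset.mem_univ, true_and, not_exists] at hqs
    exact Finsupp.notMem_support_iff.mp (hqs i)
  refine ⟨hu.coeffs.symm (Finsupp.onFinset s x hs), fun y ↦ hu.coeffs.injective ?_⟩
  ext q
  rw [hu.coeffs_lie_apply_zero, hx, LinearEquiv.apply_symm_apply, Finsupp.onFinset_apply]

variable [IsAlgClosed k]

/-- Schur's lemma for maps from `𝔤` to the loop algebra. -/
theorem exists_eq_mulBy_of_equivariant (A : 𝔤 →ₗ[k] L)
    (hA : ∀ y z : 𝔤, A ⁅y, z⁆ = ⁅u 0 y, A z⁆) : ∃ h, ∀ y, A y = hu.mulBy h (u 0 y) := by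
  have hcomp : ∀ q : ℤ, ∃ a : k, ∀ y : 𝔤, hu.coeffs (A y) q = a • y := fun q ↦
    exists_eq_smul_of_comm_lie (Finsupp.lapply q ∘ₗ hu.coeffs.toLinearMap ∘ₗ A) fun y z ↦ by
      simp [hA, hu.coeffs_apply_zero_lie]
  choose a ha using hcomp
  have := nontrivial k 𝔤
  obtain ⟨y₀, hy₀⟩ := exists_ne (0 : 𝔤)
  let h : ℤ →₀ k := Finsupp.onFinset (hu.coeffs (A y₀)).support a fun q hq ↦ by
    rw [Finsupp.mem_support_iff, ha]
    exact smul_ne_zero hq hy₀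
  refine ⟨.ofCoeff h, fun y ↦ hu.coeffs.injective ?_⟩
  ext q
  have := hu.coeffs_mulBy (.ofCoeff h) 0 q y
  rw [zero_add] at this
  rw [this, ha]
  rfl

/-- The centroid of the loop algebra consists of Laurent polynomials. -/
theorem exists_eq_mulBy (C : Module.End k L) (hC : ∀ a b : L, C ⁅a, b⁆ = ⁅a, C b⁆) :
    ∃ h, C = hu.mulBy h := by
  obtain ⟨h, hh⟩ := hu.exists_eq_mulBy_of_equivariant (C ∘ₗ u 0) fun y z ↦ by
    have := hC (u 0 y) (u 0 z)
    rwa [hu.lie, add_zero] at this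
  refine ⟨h, hu.linearMap_ext fun p ↦
    LinearMap.congr_fun (f := C ∘ₗ u p) (g := hu.mulBy h ∘ₗ u p) ?_⟩
  refine LieAlgebra.IsSimple.linearMap_ext_lie fun y z ↦ ?_
  have hyz := hu.lie p 0 y z
  rw [add_zero] at hyz
  rw [LinearMap.comp_apply, LinearMap.comp_apply, ← hyz, hC, hu.mulBy_lie]
  exact congrArg _ (hh z)

theorem exists_conj_shift_eq (f : L ≃ₗ⁅k⁆ L) :
    ∃ (n : ℤ) (a : k), a ≠ 0 ∧ ∀ l, f (hu.shift 1 (f.symm l)) = a • hu.shift n l := by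
  let conj : ℤ → Module.End k L := fun m ↦
    (f : L →ₗ[k] L) ∘ₗ hu.shift m ∘ₗ (f.symm : L →ₗ[k] L)
  have hconj : ∀ (m : ℤ) (a b : L), conj m ⁅a, b⁆ = ⁅a, conj m b⁆ := fun m a b ↦ by
    change f (hu.shift m (f.symm ⁅a, b⁆)) = ⁅a, f (hu.shift m (f.symm b))⁆
    rw [LieEquiv.map_lie, hu.shift_lie, LieEquiv.map_lie, LieEquiv.apply_symm_apply]
  obtain ⟨h, hh⟩ := hu.exists_eq_mulBy _ (hconj 1)
  obtain ⟨h', hh'⟩ := hu.exists_eq_mulBy _ (hconj (-1))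
  have hmul : h * h' = 1 := by
    apply hu.mulBy_injective
    rw [map_mul, map_one, ← hh, ← hh']
    ext l
    change f (hu.shift 1 (f.symm (f (hu.shift (-1) (f.symm l))))) = l
    rw [LieEquiv.symm_apply_apply, ← Module.End.mul_apply, ← hu.shift_add, add_neg_cancel,
      hu.shift_zero, Module.End.one_apply, LieEquiv.apply_symm_apply]
  obtain ⟨n, a, ha, rfl⟩ := AddMonoidAlgebra.exists_eq_single_of_mul_eq_one hmul
  refine ⟨n, a, ha, fun l ↦ ?_⟩
  rw [hu.mulBy_single] at hh
  exact LinearMap.congr_fun hh l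

variable [CharZero k]

/-- A derivation of the loop algebra that kills the constant loops and commutes with
multiplication by some `sⁿ`, `n ≠ 0`, vanishes. -/
theorem derivation_eq_zero (F : L →ₗ[k] L) (hF : ∀ a b : L, F ⁅a, b⁆ = ⁅F a, b⁆ + ⁅a, F b⁆)
    (hF0 : ∀ y, F (u 0 y) = 0) {n : ℤ} (hn : n ≠ 0)
    (hFn : ∀ l, F (hu.shift n l) = hu.shift n (F l)) : F = 0 := by
  have hb : ∀ p, ∃ h, ∀ y, F (u p y) = hu.mulBy h (u p y) := fun p ↦ by
    obtain ⟨h, hh⟩ := hu.exists_eq_mulBy_of_equivariant (hu.shift (-p) ∘ₗ F ∘ₗ u p) fun y z ↦ by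
      have := hF (u 0 y) (u p z)
      rw [hF0, zero_lie, zero_add, hu.lie, zero_add] at this
      rw [LinearMap.comp_apply, LinearMap.comp_apply, this, hu.shift_lie]
      rfl
    refine ⟨h, fun y ↦ ?_⟩
    have hy := congrArg (hu.shift p) (hh y)
    rw [LinearMap.comp_apply, ← Module.End.mul_apply, ← hu.shift_add, add_neg_cancel,
      hu.shift_zero, Module.End.one_apply, LinearMap.comp_apply] at hy
    have hs : hu.mulBy (AddMonoidAlgebra.single p 1) = hu.shift p := by
      rw [hu.mulBy_single, one_smul]
    rw [hy, ← hs, ← Module.End.mul_apply, ← map_mul, mul_comm, map_mul, Module.End.mul_apply, hs,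
      hu.shift_apply, zero_add]
  choose b hb using hb
  obtain ⟨y, z, w, hyz⟩ := exists_killingForm_lie_ne_zero k 𝔤
  have hne : ⁅y, z⁆ ≠ 0 := by
    intro h0
    rw [h0] at hyz
    simp at hyz
  have hadd : ∀ p q, b (p + q) = b p + b q := fun p q ↦ by
    refine sub_eq_zero.mp (hu.eq_zero_of_mulBy_apply_eq_zero (p := p + q) hne ?_)
    have := hF (u p y) (u q z)
    rw [hu.lie, hb, hb, hb, ← hu.mulBy_lie, ← hu.mulBy_lie_left, hu.lie] at this
    simp [map_sub, this]
  let b' : ℤ →+ AddMonoidAlgebra k ℤ := AddMonoidHom.mk' b hadd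
  have hbn : b n = 0 := by
    refine hu.eq_zero_of_mulBy_apply_eq_zero (p := n) hne ?_
    have := hFn (u 0 ⁅y, z⁆)
    rwa [hF0, map_zero, hu.shift_apply, zero_add, hb] at this
  refine hu.linearMap_ext fun p v ↦ ?_
  have hnp : n • b p = 0 := by
    have h1 : n • b' p = p • b' n := by
      rw [← map_zsmul, ← map_zsmul, smul_eq_mul, smul_eq_mul, mul_comm]
    exact h1.trans (by change p • b n = 0; rw [hbn, smul_zero])
  have hnp' : (n : k) • hu.mulBy (b p) = 0 := by
    rw [← map_smul, Int.cast_smul_eq_zsmul, hnp, map_zero]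
  rw [smul_eq_zero] at hnp'
  rw [hb, hnp'.resolve_left (by exact_mod_cast hn)]

theorem exists_conj_deg_eq (f : L ≃ₗ⁅k⁆ L) :
    ∃ (ε : k) (x : L), ε ≠ 0 ∧ ∀ l, f (hu.deg l) = ε • hu.deg (f l) + ⁅x, f l⁆ := by
  obtain ⟨n, a, ha, hn⟩ := hu.exists_conj_shift_eq f
  let E : Module.End k L := (f : L →ₗ[k] L) ∘ₗ hu.deg ∘ₗ (f.symm : L →ₗ[k] L)
  have hEapp : ∀ l, E l = f (hu.deg (f.symm l)) := fun l ↦ rfl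
  have hE : ∀ l m : L, E ⁅l, m⁆ = ⁅E l, m⁆ + ⁅l, E m⁆ := fun l m ↦ by
    simp only [hEapp, LieEquiv.map_lie, hu.deg_lie, map_add, LieEquiv.apply_symm_apply]
  have hEn : ∀ l, E (hu.shift n l) = hu.shift n (E l) + hu.shift n l := fun l ↦ by
    refine smul_right_injective L ha ?_
    change a • E (hu.shift n l) = a • (hu.shift n (E l) + hu.shift n l)
    rw [← map_smul, ← hn, smul_add, ← hn, ← hn, hEapp, hEapp, LieEquiv.symm_apply_apply,
      LieEquiv.symm_apply_apply, hu.deg_shift, Int.cast_one, one_smul, map_add]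
  have hn0 : n ≠ 0 := by
    rintro rfl
    have := nontrivial k 𝔤
    obtain ⟨y, hy⟩ := exists_ne (0 : 𝔤)
    have h1 := hEn (u 0 y)
    rw [hu.shift_zero, Module.End.one_apply, Module.End.one_apply, left_eq_add] at h1
    have h2 := hu.coeffs_apply 0 y
    rw [h1, map_zero, eq_comm, Finsupp.single_eq_zero] at h2
    exact hy h2
  have hnk : (n : k) ≠ 0 := by exact_mod_cast hn0
  obtain ⟨x, hx⟩ := hu.exists_eq_lie_of_derivation (E ∘ₗ u 0) fun y z ↦ by
    have := hE (u 0 y) (u 0 z)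
    rwa [hu.lie, add_zero, add_comm] at this
  have hzero := hu.derivation_eq_zero (E - (n : k)⁻¹ • hu.deg - LieModule.toEnd k L L x)
    (fun l m ↦ by
      simp only [LinearMap.sub_apply, LinearMap.smul_apply, LieModule.toEnd_apply_apply, hE,
        hu.deg_lie, sub_lie, lie_sub, smul_lie, lie_smul, smul_add, leibniz_lie x l m]
      abel)
    (fun y ↦ by
      have : E (u 0 y) = ⁅x, u 0 y⁆ := hx y
      simp [this]) hn0
    (fun l ↦ by
      simp only [LinearMap.sub_apply, LinearMap.smul_apply, LieModule.toEnd_apply_apply, hEn,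
        hu.deg_shift, ← hu.shift_lie, map_sub, map_smul, smul_add, inv_smul_smul₀ hnk]
      abel)
  refine ⟨(n : k)⁻¹, x, inv_ne_zero hnk, fun l ↦ ?_⟩
  have h := LinearMap.congr_fun hzero (f l)
  simp only [LinearMap.sub_apply, LinearMap.smul_apply, LieModule.toEnd_apply_apply, hEapp,
    LieEquiv.symm_apply_apply, LinearMap.zero_apply] at h
  rwa [sub_sub, sub_eq_zero] at h

/-- Invariant forms on the loop algebra compatible with the degree derivation are multiples of
the residue form. -/
theorem exists_eq_smul_form (β : L →ₗ[k] L →ₗ[k] k) (hβ : ∀ x a b : L, β ⁅x, a⁆ b = -β a ⁅x, b⁆)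
    (hdeg : ∀ a b, β (hu.deg a) b = -β a (hu.deg b)) : ∃ γ : k, β = γ • hu.form := by
  obtain ⟨γ, hγ⟩ := exists_eq_mul_killingForm (β.compl₁₂ (u 0) (u 0)) fun x y z ↦ by
    have := hβ (u 0 x) (u 0 y) (u 0 z)
    rwa [hu.lie, hu.lie, add_zero] at this
  refine ⟨γ, hu.bilin_ext fun p y q z ↦ ?_⟩
  rw [LinearMap.smul_apply, LinearMap.smul_apply, hu.form_apply]
  split_ifs with hpq
  · obtain rfl : q = -p := eq_neg_of_add_eq_zero_right hpq
    refine LinearMap.congr_fun (f := β.flip (u (-p) z) ∘ₗ u p)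
      (g := γ • (killingForm k 𝔤).flip z) ?_ y
    refine LieAlgebra.IsSimple.linearMap_ext_lie fun v w ↦ ?_
    have h1 := hβ (u p v) (u 0 w) (u (-p) z)
    rw [hu.lie, hu.lie, add_zero, add_neg_cancel] at h1
    have h2 : β (u 0 w) (u 0 ⁅v, z⁆) = γ * killingForm k 𝔤 w ⁅v, z⁆ := hγ w ⁅v, z⁆
    have h3 : killingForm k 𝔤 ⁅v, w⁆ z = -killingForm k 𝔤 w ⁅v, z⁆ := by
      rw [← lie_skew, map_neg, LinearMap.neg_apply, LieModule.traceForm_apply_lie_apply]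
    change β (u p ⁅v, w⁆) (u (-p) z) = γ • killingForm k 𝔤 ⁅v, w⁆ z
    rw [h1, h2, h3, smul_eq_mul, mul_neg]
  · have h := hdeg (u p y) (u q z)
    rw [hu.deg_apply, hu.deg_apply, map_smul, map_smul, LinearMap.smul_apply, smul_eq_mul,
      smul_eq_mul, eq_neg_iff_add_eq_zero, ← add_mul, mul_eq_zero] at h
    rw [smul_zero]
    exact h.resolve_left (by exact_mod_cast hpq)

theorem exists_form_map_eq (f : L ≃ₗ⁅k⁆ L) :
    ∃ γ : k, γ ≠ 0 ∧ ∀ a b, hu.form (f a) (f b) = γ * hu.form a b := by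
  obtain ⟨ε, x, -, hf⟩ := hu.exists_conj_deg_eq f
  obtain ⟨γ, hγ⟩ := hu.exists_eq_smul_form (hu.form.compl₁₂ (f : L →ₗ[k] L) (f : L →ₗ[k] L))
    (fun z a b ↦ by
      change hu.form (f ⁅z, a⁆) (f b) = -hu.form (f a) (f ⁅z, b⁆)
      rw [LieEquiv.map_lie, LieEquiv.map_lie, hu.form_lie])
    (fun a b ↦ by
      change hu.form (f (hu.deg a)) (f b) = -hu.form (f a) (f (hu.deg b))
      rw [hf, hf, map_add, map_add, map_smul, map_smul, LinearMap.add_apply, LinearMap.smul_apply,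
        hu.form_deg, hu.form_lie, smul_neg, neg_add])
  have hfab : ∀ a b, hu.form (f a) (f b) = γ * hu.form a b := LinearMap.congr_fun₂ hγ
  refine ⟨γ, ?_, hfab⟩
  rintro rfl
  obtain ⟨y, z, w, hyz⟩ := exists_killingForm_lie_ne_zero k 𝔤
  have h := hfab (f.symm (u 0 ⁅y, z⁆)) (f.symm (u 0 w))
  rw [LieEquiv.apply_symm_apply, LieEquiv.apply_symm_apply, hu.form_apply, if_pos (add_zero 0),
    zero_mul] at h
  exact hyz h

end Structure

end IsLoopAlgebra

/-- The Lie algebra `A = L ⊕ kc ⊕ kd` is the split affine Kac–Moody algebra of the loop algebra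
`L` of `𝔤`. -/
structure IsAffineAlgebra {k 𝔤 L A : Type*} [Field k] [LieRing 𝔤] [LieAlgebra k 𝔤] [LieRing L]
    [LieAlgebra k L] [LieRing A] [LieAlgebra k A] (u : ℤ → 𝔤 →ₗ[k] L) (c d : A)
    (ι : L →ₗ[k] A) : Prop where
  c_lie : ∀ z : A, ⁅c, z⁆ = 0
  d_lie_apply : ∀ (p : ℤ) (y : 𝔤), ⁅d, ι (u p y)⁆ = (p : k) • ι (u p y)
  lie_apply : ∀ (p q : ℤ) (y z : 𝔤), ⁅ι (u p y), ι (u q z)⁆ =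
    ι (u (p + q) ⁅y, z⁆) + (if p + q = 0 then (p : k) * killingForm k 𝔤 y z else 0) • c
  span : ∀ z : A, ∃ (l : L) (a b : k), z = ι l + a • c + b • d
  ind : ∀ (l : L) (a b : k), ι l + a • c + b • d = 0 → l = 0 ∧ a = 0 ∧ b = 0

namespace IsAffineAlgebra

open LieAlgebra.IsSimple

variable {k 𝔤 L A : Type*} [Field k] [LieRing 𝔤] [LieAlgebra k 𝔤] [LieRing L]
    [LieAlgebra k L] [LieRing A] [LieAlgebra k A] {u : ℤ → 𝔤 →ₗ[k] L} {c d : A}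
    {ι : L →ₗ[k] A} (hA : IsAffineAlgebra u c d ι)

section Coordinates

include hA in
theorem bijective_coprod : Function.Bijective (ι.coprod
    ((LinearMap.toSpanSingleton k A c).coprod (LinearMap.toSpanSingleton k A d))) := by
  refine ⟨(injective_iff_map_eq_zero _).mpr ?_, fun z ↦ ?_⟩
  · rintro ⟨l, a, b⟩ h
    obtain ⟨rfl, rfl, rfl⟩ := hA.ind l a b (by simpa [add_assoc] using h)
    rfl
  · obtain ⟨l, a, b, rfl⟩ := hA.span z
    exact ⟨(l, a, b), by simp [add_assoc]⟩

/-- The coordinates of an affine algebra with respect to the decomposition `L ⊕ kc ⊕ kd`. -/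
def coords : A ≃ₗ[k] L × k × k := (LinearEquiv.ofBijective _ hA.bijective_coprod).symm

theorem coords_apply (l : L) (a b : k) : hA.coords (ι l + a • c + b • d) = (l, a, b) := by
  rw [coords, LinearEquiv.symm_apply_eq, LinearEquiv.ofBijective_apply]
  simp [add_assoc]

/-- The projection of an affine algebra to its loop algebra. -/
def loopPart : A →ₗ[k] L := LinearMap.fst k L (k × k) ∘ₗ hA.coords.toLinearMap

/-- The coefficient of the central element `c`. -/
def cPart : A →ₗ[k] k :=
  LinearMap.fst k k k ∘ₗ LinearMap.snd k L (k × k) ∘ₗ hA.coords.toLinearMap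

/-- The coefficient of the degree derivation `d`. -/
def dPart : A →ₗ[k] k :=
  LinearMap.snd k k k ∘ₗ LinearMap.snd k L (k × k) ∘ₗ hA.coords.toLinearMap

@[simp]
theorem loopPart_apply (l : L) (a b : k) : hA.loopPart (ι l + a • c + b • d) = l :=
  congrArg Prod.fst (hA.coords_apply l a b)

@[simp]
theorem cPart_apply (l : L) (a b : k) : hA.cPart (ι l + a • c + b • d) = a :=
  congrArg (fun x ↦ x.2.1) (hA.coords_apply l a b)

@[simp]
theorem dPart_apply (l : L) (a b : k) : hA.dPart (ι l + a • c + b • d) = b :=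
  congrArg (fun x ↦ x.2.2) (hA.coords_apply l a b)

theorem loopPart_apply_add (l : L) (a : k) : hA.loopPart (ι l + a • c) = l := by
  simpa using hA.loopPart_apply l a 0

theorem dPart_apply_add (l : L) (a : k) : hA.dPart (ι l + a • c) = 0 := by
  simpa using hA.dPart_apply l a 0

theorem eq_coords (z : A) : z = ι (hA.loopPart z) + hA.cPart z • c + hA.dPart z • d := by
  obtain ⟨l, a, b, rfl⟩ := hA.span z
  simp

include hA in
theorem eq_and_eq_of_add_eq {l l' : L} {a a' : k} (h : ι l + a • c = ι l' + a' • c) :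
    l = l' ∧ a = a' := by
  have h' : ι l + a • c + (0 : k) • d = ι l' + a' • c + (0 : k) • d := by rw [h]
  have := congrArg hA.coords h'
  rw [coords_apply, coords_apply] at this
  simpa using this

end Coordinates

section Bracket

variable (hu : IsLoopAlgebra u)

include hA in
theorem lie_map_map (a b : L) : ⁅ι a, ι b⁆ = ι ⁅a, b⁆ + hu.form (hu.deg a) b • c := by
  have := hu.bilin_ext
    (F := (LieModule.toEnd k A A : A →ₗ[k] A →ₗ[k] A).compl₁₂ ι ι)
    (G := (LieModule.toEnd k L L : L →ₗ[k] L →ₗ[k] L).compr₂ ι +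
      (hu.form ∘ₗ hu.deg).compr₂ (LinearMap.toSpanSingleton k A c))
    (fun p y q z ↦ by
      have h := hA.lie_apply p q y z
      simp only [LinearMap.compl₁₂_apply, LinearMap.add_apply, LinearMap.compr₂_apply,
        LinearMap.comp_apply, LieHom.coe_toLinearMap, LieModule.toEnd_apply_apply, h, hu.lie,
        hu.deg_apply, map_smul, LinearMap.smul_apply, hu.form_apply,
        LinearMap.toSpanSingleton_apply]
      split_ifs <;> simp [mul_smul])
  exact LinearMap.congr_fun₂ this a b

include hA in
theorem d_lie_map (a : L) : ⁅d, ι a⁆ = ι (hu.deg a) := by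
  have := hu.linearMap_ext (F := LieModule.toEnd k A A d ∘ₗ ι) (G := ι ∘ₗ hu.deg)
    (fun p y ↦ by simp [hA.d_lie_apply])
  exact LinearMap.congr_fun this a

include hA in
theorem lie_c (z : A) : ⁅z, c⁆ = 0 := by rw [← lie_skew, hA.c_lie, neg_zero]

include hA in
theorem lie_add_add (l l' : L) (a a' b b' : k) :
    ⁅ι l + a • c + b • d, ι l' + a' • c + b' • d⁆ =
      ι (⁅l, l'⁆ + b • hu.deg l' - b' • hu.deg l) + hu.form (hu.deg l) l' • c := by
  have h : ⁅ι l, d⁆ = -ι (hu.deg l) := by rw [← lie_skew, hA.d_lie_map hu]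
  simp only [add_lie, lie_add, smul_lie, lie_smul, hA.c_lie, hA.lie_c, lie_self, smul_zero,
    hA.d_lie_map hu, h, hA.lie_map_map hu, map_add, map_sub, map_smul]
  module

include hu in
theorem dPart_lie (z w : A) : hA.dPart ⁅z, w⁆ = 0 := by
  rw [hA.eq_coords z, hA.eq_coords w, hA.lie_add_add hu, dPart_apply_add]

include hA hu in
theorem exists_eq_smul_of_central [LieAlgebra.IsSimple k 𝔤] {z : A} (hz : ∀ w : A, ⁅z, w⁆ = 0) :
    ∃ γ : k, z = γ • c := by
  obtain ⟨l, a, b, rfl⟩ := hA.span z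
  have hl : ∀ l', ⁅l, l'⁆ + b • hu.deg l' = 0 := fun l' ↦ by
    have h := hz (ι l' + (0 : k) • c + (0 : k) • d)
    rw [hA.lie_add_add hu, zero_smul, sub_zero] at h
    refine (hA.eq_and_eq_of_add_eq (a' := 0) (h.trans ?_)).1
    simp
  obtain rfl : l = 0 := hu.eq_zero_of_forall_lie_apply_zero fun y ↦ by
    simpa using hl (u 0 y)
  have := nontrivial k 𝔤
  obtain ⟨y, hy⟩ := exists_ne (0 : 𝔤)
  have hb := hl (u 1 y)
  rw [zero_lie, zero_add, hu.deg_apply, Int.cast_one, one_smul, smul_eq_zero] at hb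
  have hb0 : b = 0 := hb.resolve_right fun h0 ↦ hy (by
    have := hu.coeffs_apply 1 y
    rwa [h0, map_zero, eq_comm, Finsupp.single_eq_zero] at this)
  exact ⟨a, by simp [hb0]⟩

end Bracket

section Automorphisms

variable (hu : IsLoopAlgebra u) [LieAlgebra.IsSimple k 𝔤]

include hA hu

theorem exists_map_c (φ : A ≃ₗ⁅k⁆ A) : ∃ γ : k, φ c = γ • c :=
  hA.exists_eq_smul_of_central hu fun w ↦ by
    rw [← φ.apply_symm_apply w, ← LieEquiv.map_lie, hA.c_lie, map_zero]

theorem loopPart_map_c (φ : A ≃ₗ⁅k⁆ A) : hA.loopPart (φ c) = 0 := by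
  obtain ⟨γ, hγ⟩ := hA.exists_map_c hu φ
  simpa [hγ] using hA.loopPart_apply_add 0 γ

theorem map_map_eq (φ : A ≃ₗ⁅k⁆ A) (l : L) :
    φ (ι l) = ι (hA.loopPart (φ (ι l))) + hA.cPart (φ (ι l)) • c := by
  have h : hA.dPart ∘ₗ (φ : A →ₗ[k] A) ∘ₗ ι = 0 := hu.linearMap_ext_lie fun a b ↦ by
    obtain ⟨γ, hγ⟩ := hA.exists_map_c hu φ
    have h1 : ι ⁅a, b⁆ = ⁅ι a, ι b⁆ - hu.form (hu.deg a) b • c := by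
      rw [hA.lie_map_map hu, add_sub_cancel_right]
    have h2 : hA.dPart c = 0 := by simpa using hA.dPart_apply_add 0 1
    change hA.dPart (φ (ι ⁅a, b⁆)) = 0
    rw [h1, map_sub, map_smul, LieEquiv.map_lie, map_sub, hA.dPart_lie hu, hγ, map_smul, map_smul,
      h2, smul_zero, smul_zero, sub_zero]
  have hd : hA.dPart (φ (ι l)) = 0 := LinearMap.congr_fun h l
  conv_lhs => rw [hA.eq_coords (φ (ι l)), hd, zero_smul, add_zero]

theorem loopPart_map_map (φ ψ : A ≃ₗ⁅k⁆ A) (l : L) :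
    hA.loopPart (φ (ι (hA.loopPart (ψ (ι l))))) = hA.loopPart (φ (ψ (ι l))) := by
  conv_rhs => rw [hA.map_map_eq hu ψ l, map_add, map_add, map_smul, map_smul,
    hA.loopPart_map_c hu, smul_zero, add_zero]

/-- The automorphism of the loop algebra induced by an automorphism of the affine algebra. -/
def loopAut (φ : A ≃ₗ⁅k⁆ A) : L ≃ₗ⁅k⁆ L where
  toFun l := hA.loopPart (φ (ι l))
  invFun l := hA.loopPart (φ.symm (ι l))
  map_add' a b := by simp
  map_smul' r a := by simp
  map_lie' := by
    intro a b
    have h := hA.map_map_eq hu φ a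
    have h' := hA.map_map_eq hu φ b
    have h1 : ι ⁅a, b⁆ = ⁅ι a, ι b⁆ - hu.form (hu.deg a) b • c := by
      rw [hA.lie_map_map hu, add_sub_cancel_right]
    change hA.loopPart (φ (ι ⁅a, b⁆)) = _
    rw [h1, map_sub, map_sub, map_smul, map_smul, hA.loopPart_map_c hu, smul_zero, sub_zero,
      LieEquiv.map_lie, h, h', add_lie, lie_add, smul_lie, hA.c_lie, smul_zero, add_zero,
      lie_smul, hA.lie_c, smul_zero, add_zero, hA.lie_map_map hu, hA.loopPart_apply_add,
      hA.loopPart_apply_add, hA.loopPart_apply_add]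
  left_inv l := by
    change hA.loopPart (φ.symm (ι (hA.loopPart (φ (ι l))))) = l
    rw [hA.loopPart_map_map hu, LieEquiv.symm_apply_apply]
    simpa using hA.loopPart_apply_add l 0
  right_inv l := by
    change hA.loopPart (φ (ι (hA.loopPart (φ.symm (ι l))))) = l
    rw [hA.loopPart_map_map hu, LieEquiv.apply_symm_apply]
    simpa using hA.loopPart_apply_add l 0

theorem loopAut_apply (φ : A ≃ₗ⁅k⁆ A) (l : L) :
    hA.loopAut hu φ l = hA.loopPart (φ (ι l)) := rfl

variable [CharZero k] [FiniteDimensional k 𝔤]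

theorem loopAut_eq_refl_iff (φ : A ≃ₗ⁅k⁆ A) :
    hA.loopAut hu φ = LieEquiv.refl ↔
      ∃ a : k, (∀ l : L, φ (ι l) = ι l) ∧ φ c = c ∧ φ d = d + a • c := by
  constructor
  · intro h
    obtain ⟨γ, hγ⟩ := hA.exists_map_c hu φ
    let μ : L →ₗ[k] k := hA.cPart ∘ₗ (φ : A →ₗ[k] A) ∘ₗ ι
    have hμ : ∀ l, φ (ι l) = ι l + μ l • c := fun l ↦ by
      have hl : hA.loopPart (φ (ι l)) = l := congrArg (fun f : L ≃ₗ⁅k⁆ L ↦ f l) h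
      conv_lhs => rw [hA.map_map_eq hu φ l, hl]
      rfl
    obtain ⟨x, a, b, hxab⟩ := hA.span (φ d)
    have hdl : ∀ l, ⁅x, l⁆ + b • hu.deg l = hu.deg l ∧
        hu.form (hu.deg x) l = μ (hu.deg l) := fun l ↦ by
      have h1 : ⁅φ d, φ (ι l)⁆ = φ (ι (hu.deg l)) := by
        rw [← LieEquiv.map_lie, hA.d_lie_map hu]
      have h2 := hA.lie_add_add hu x l a (μ l) b 0
      rw [zero_smul, zero_smul, add_zero, sub_zero, ← hxab, ← hμ, h1, hμ] at h2
      have h3 := hA.eq_and_eq_of_add_eq h2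
      exact ⟨h3.1.symm, h3.2.symm⟩
    obtain rfl : x = 0 := hu.eq_zero_of_forall_lie_apply_zero fun y ↦ by
      simpa using (hdl (u 0 y)).1
    have hbr : ∀ a b, μ ⁅a, b⁆ + hu.form (hu.deg a) b * γ = hu.form (hu.deg a) b := fun a b ↦ by
      have h1 : ⁅φ (ι a), φ (ι b)⁆ = φ (ι ⁅a, b⁆ + hu.form (hu.deg a) b • c) := by
        rw [← LieEquiv.map_lie, hA.lie_map_map hu]
      rw [map_add, map_smul, hγ, hμ, hμ, hμ, add_lie, lie_add, smul_lie, hA.c_lie, smul_zero,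
        add_zero, lie_smul, hA.lie_c, smul_zero, add_zero, hA.lie_map_map hu, add_assoc,
        smul_smul, ← add_smul] at h1
      exact (hA.eq_and_eq_of_add_eq h1).2.symm
    have hμ0 : μ = 0 := hu.linearMap_ext fun p y ↦ by
      by_cases hp : p = 0
      · subst hp
        refine LinearMap.congr_fun (f := μ ∘ₗ u 0) (g := 0)
          (LieAlgebra.IsSimple.linearMap_ext_lie fun y z ↦ ?_) y
        simpa [hu.lie] using hbr (u 0 y) (u 0 z)
      · have h1 := (hdl (u p y)).2
        rw [map_zero, map_zero, LinearMap.zero_apply, hu.deg_apply, map_smul, eq_comm,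
          smul_eq_zero] at h1
        exact h1.resolve_left (by exact_mod_cast hp)
    obtain ⟨y, z, w, hyz⟩ := exists_killingForm_lie_ne_zero k 𝔤
    have hγ1 : γ = 1 := by
      have h1 := hbr (u 1 ⁅y, z⁆) (u (-1) w)
      rw [hμ0, LinearMap.zero_apply, zero_add, hu.deg_apply, Int.cast_one, one_smul, hu.form_apply,
        if_pos (add_neg_cancel 1)] at h1
      exact (mul_eq_left₀ hyz).mp h1
    have hb1 : b = 1 := by
      have h1 := (hdl (u 1 ⁅y, z⁆)).1
      rw [zero_lie, zero_add, hu.deg_apply, Int.cast_one, one_smul] at h1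
      have h2 := congrArg (fun v ↦ hu.form v (u (-1) w)) h1
      simp only [map_smul, LinearMap.smul_apply, hu.form_apply, add_neg_cancel, if_true,
        smul_eq_mul] at h2
      exact (mul_eq_right₀ hyz).mp h2
    refine ⟨a, fun l ↦ ?_, ?_, ?_⟩
    · rw [hμ, hμ0, LinearMap.zero_apply, zero_smul, add_zero]
    · rw [hγ, hγ1, one_smul]
    · rw [hxab, hb1, map_zero, zero_add, one_smul, add_comm]
  · rintro ⟨a, hι, -, -⟩
    ext l
    rw [loopAut_apply, hι]
    simpa using hA.loopPart_apply_add l 0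

theorem exists_loopAut_eq [IsAlgClosed k] (f : L ≃ₗ⁅k⁆ L) : ∃ φ, hA.loopAut hu φ = f := by
  obtain ⟨ε, x, hε, hf⟩ := hu.exists_conj_deg_eq f
  obtain ⟨γ, hγ, hform⟩ := hu.exists_form_map_eq f
  let Φ : A →ₗ[k] A := ι ∘ₗ (f : L →ₗ[k] L) ∘ₗ hA.loopPart +
    LinearMap.toSpanSingleton k A c ∘ₗ
      (-ε⁻¹ • (hu.form x ∘ₗ (f : L →ₗ[k] L) ∘ₗ hA.loopPart) + (ε⁻¹ * γ) • hA.cPart) +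
    LinearMap.toSpanSingleton k A (ε • d + ι x) ∘ₗ hA.dPart
  have hΦ : ∀ l a b, Φ (ι l + a • c + b • d) =
      ι (f l + b • x) + (-ε⁻¹ * hu.form x (f l) + ε⁻¹ * γ * a) • c + (b * ε) • d := by
    intro l a b
    simp only [Φ, LinearMap.add_apply, LinearMap.comp_apply, LinearMap.smul_apply,
      loopPart_apply, cPart_apply, dPart_apply, LinearMap.toSpanSingleton_apply]
    change ι (f l) + (-ε⁻¹ * hu.form x (f l) + ε⁻¹ * γ * a) • c + b • (ε • d + ι x) = _
    rw [map_add, map_smul]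
    module
  have hself : hu.form (hu.deg x) x = 0 := by
    have h := hu.form_deg x x
    rw [hu.form_comm x, eq_neg_iff_add_eq_zero, ← two_mul] at h
    simpa using h
  have hxx : ∀ y, hu.form x ⁅x, y⁆ = 0 := fun y ↦ by
    have h := hu.form_lie x x y
    rwa [lie_self, map_zero, LinearMap.zero_apply, zero_eq_neg] at h
  have hlie : ∀ z w, Φ ⁅z, w⁆ = ⁅Φ z, Φ w⁆ := by
    intro z w
    obtain ⟨l, a, b, rfl⟩ := hA.span z
    obtain ⟨l', a', b', rfl⟩ := hA.span w
    have h0 := fun (m : L) (e : k) ↦ hΦ m e 0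
    simp only [zero_smul, add_zero, zero_mul] at h0
    rw [hΦ, hΦ, hA.lie_add_add hu, hA.lie_add_add hu, h0]
    congr 2
    · simp only [map_sub, map_add, map_smul, LieEquiv.map_lie, hf, add_lie, lie_add, smul_lie,
        lie_smul, lie_self, ← lie_skew (f l) x]
      module
    · have h1 : ε * hu.form (hu.deg (f l)) (f l') =
          γ * hu.form (hu.deg l) l' - hu.form ⁅x, f l⁆ (f l') := by
        rw [← hform, hf, map_add, map_smul, LinearMap.add_apply, LinearMap.smul_apply, smul_eq_mul,
          add_sub_cancel_right]
      have h2 : hu.form x ⁅f l, f l'⁆ = hu.form ⁅x, f l⁆ (f l') := by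
        rw [← lie_skew x, map_neg, LinearMap.neg_apply, hu.form_lie, neg_neg]
      have h3 : ∀ y, hu.form x (hu.deg y) = -hu.form (hu.deg x) y := fun y ↦ by
        rw [hu.form_deg, neg_neg]
      have h4 : hu.form (hu.deg (f l)) x = -hu.form (hu.deg x) (f l) := by
        rw [← h3, hu.form_comm]
      simp only [map_sub, map_add, map_smul, LieEquiv.map_lie, hf, LinearMap.add_apply,
        LinearMap.smul_apply, smul_eq_mul, hxx, hself, h2, h3, h4]
      field_simp
      linear_combination -h1
  have hbij : Function.Bijective Φ := by
    refine ⟨(injective_iff_map_eq_zero _).mpr fun z hz ↦ ?_, fun w ↦ ?_⟩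
    · obtain ⟨l, a, b, rfl⟩ := hA.span z
      rw [hΦ] at hz
      obtain ⟨h1, h2, h3⟩ := hA.ind _ _ _ hz
      obtain rfl : b = 0 := (mul_eq_zero.mp h3).resolve_right hε
      rw [zero_smul, add_zero] at h1
      obtain rfl : l = 0 := f.injective (h1.trans (map_zero f).symm)
      rw [h1, map_zero, mul_zero, zero_add] at h2
      obtain rfl : a = 0 := (mul_eq_zero.mp h2).resolve_left (mul_ne_zero (inv_ne_zero hε) hγ)
      simp
    · obtain ⟨l, a, b, rfl⟩ := hA.span w
      refine ⟨ι (f.symm (l - (b * ε⁻¹) • x)) +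
        (γ⁻¹ * (ε * a + hu.form x (l - (b * ε⁻¹) • x))) • c + (b * ε⁻¹) • d, ?_⟩
      rw [hΦ, LieEquiv.apply_symm_apply, sub_add_cancel, inv_mul_cancel_right₀ hε]
      congr 3
      field_simp
      ring
  refine ⟨LieEquiv.ofBijective { Φ with map_lie' := fun {z w} ↦ hlie z w } hbij, ?_⟩
  ext l
  rw [loopAut_apply]
  change hA.loopPart (Φ (ι l)) = f l
  have := hΦ l 0 0
  rw [zero_smul, zero_smul, add_zero, add_zero] at this
  rw [this, loopPart_apply, zero_smul, add_zero]

end Automorphisms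

end IsAffineAlgebra

/-- The sequence
`1 → V → Aut_{k-Lie}(L̂(𝔤)_S) → Aut_{k-Lie}(L(𝔤)_S) → 1` is exact, where the second
map is `λ∘τ` (restrict to the derived subalgebra, then mod out the centre `kc`), and
`V = Hom_k(kd, kc) ≅ (k,+)`. -/
theorem exact_sequence_of_automorphisms
    -- the base field
    (k : Type) [Field k] [IsAlgClosed k] [CharZero k]
    -- the simple finite-dimensional Lie algebra 𝔤
    (𝔤 : Type) [LieRing 𝔤] [LieAlgebra k 𝔤] [FiniteDimensional k 𝔤]
    [LieAlgebra.IsSimple k 𝔤]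
    -- the loop algebra L(𝔤)_S = 𝔤 ⊗_k S, S = k[s^{±1}]; `u p y` represents `y ⊗ sᵖ`
    (Lg : Type) [LieRing Lg] [LieAlgebra k Lg]
    (u : ℤ → 𝔤 →ₗ[k] Lg)
    (hu_bracket : ∀ (p q : ℤ) (y z : 𝔤), ⁅u p y, u q z⁆ = u (p + q) ⁅y, z⁆)
    (hu_span : ∀ l : Lg, ∃ f : ℤ →₀ 𝔤, l = f.sum fun i yi => u i yi)
    (hu_ind : ∀ f : ℤ →₀ 𝔤, (f.sum fun i yi => u i yi) = 0 → f = 0)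
    -- the split affine Kac–Moody algebra L̂(𝔤)_S = L(𝔤)_S ⊕ kc ⊕ kd
    (Lhat : Type) [LieRing Lhat] [LieAlgebra k Lhat]
    (c d : Lhat) (ι : Lg →ₗ[k] Lhat)
    (hc : ∀ z : Lhat, ⁅c, z⁆ = 0)
    (hd : ∀ (p : ℤ) (y : 𝔤), ⁅d, ι (u p y)⁆ = (p : k) • ι (u p y))
    (hbr : ∀ (p q : ℤ) (y z : 𝔤),
      ⁅ι (u p y), ι (u q z)⁆ =
        ι (u (p + q) ⁅y, z⁆) +
          (if p + q = 0 then (p : k) * killingForm k 𝔤 y z else 0) • c)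
    (hdec : ∀ z : Lhat, ∃ (l : Lg) (a b : k), z = ι l + a • c + b • d)
    (huniq : ∀ (l : Lg) (a b : k), ι l + a • c + b • d = 0 → l = 0 ∧ a = 0 ∧ b = 0)
    :
    ∃ P : (Lhat ≃ₗ⁅k⁆ Lhat) → (Lg ≃ₗ⁅k⁆ Lg),
      (∀ (φ : Lhat ≃ₗ⁅k⁆ Lhat) (l : Lg), ∃ μ : k, φ (ι l) = ι (P φ l) + μ • c) ∧
      (∀ φ₁ φ₂ : Lhat ≃ₗ⁅k⁆ Lhat, P (φ₁.trans φ₂) = (P φ₁).trans (P φ₂)) ∧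
      (∀ f : Lg ≃ₗ⁅k⁆ Lg, ∃ φ : Lhat ≃ₗ⁅k⁆ Lhat, P φ = f) ∧
      (∀ φ : Lhat ≃ₗ⁅k⁆ Lhat,
        P φ = LieEquiv.refl ↔
          ∃ a : k, (∀ l : Lg, φ (ι l) = ι l) ∧ φ c = c ∧ φ d = d + a • c) := by
  have hu : IsLoopAlgebra u := ⟨hu_bracket, hu_span, hu_ind⟩
  have hA : IsAffineAlgebra u c d ι := ⟨hc, hd, hbr, hdec, huniq⟩
  refine ⟨hA.loopAut hu, fun φ l ↦ ⟨_, hA.map_map_eq hu φ l⟩, fun φ₁ φ₂ ↦ ?_,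
    hA.exists_loopAut_eq hu, hA.loopAut_eq_refl_iff hu⟩
  ext l
  exact (hA.loopPart_map_map hu φ₂ φ₁ l).symm
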